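/- Let Φ : ℝ → ℝ be continuously differentiable with Φ(0) = 0. Suppose E, B : ℝ × ℝ³ → ℝ³ are continuous, F : ℝ × ℝ³ × ℝ³ → ℝ is continuously differentiable, there is a compact set K ⊆ ℝ³ × ℝ³ such that F(t,x,v) = 0 whenever (x,v) ∉ K, and F satisfies the Vlasov equation with fields E and B. Then the entropy-type Casimir functional t ↦ ∫∫ Φ(F(t,x,v)) dx dv is constant on ℝ. (These are the Casimir invariants of the Morrison–Greene bracket recovered from the reduced Skinner–Rusk structure.) -/

import Mathlib

noncomputable section

open MeasureTheory

/-- Physical space `ℝ³`, identified with `EuclideanSpace ℝ (Fin 3)`. -/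
abbrev R3 : Type := EuclideanSpace ℝ (Fin 3)

/-- Euclidean dot product on `ℝ³`. -/
def dot (a b : R3) : ℝ := ∑ i, a i * b i

/-- Cross product on `ℝ³`. -/
def cross (a b : R3) : R3 :=
  (WithLp.equiv 2 (Fin 3 → ℝ)).symm
    ![a 1 * b 2 - a 2 * b 1, a 2 * b 0 - a 0 * b 2, a 0 * b 1 - a 1 * b 0]

/-- Time derivative `∂t` of a map on `ℝ × ℝ³`. -/
def pt {E : Type*} [NormedAddCommGroup E] [NormedSpace ℝ E]
    (f : ℝ × R3 → E) (t : ℝ) (x : R3) : E :=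
  fderiv ℝ (fun s => f (s, x)) t 1

/-- Spatial partial derivative in coordinate direction `i`. -/
def pd (i : Fin 3) (g : R3 → ℝ) (x : R3) : ℝ :=
  fderiv ℝ g x (EuclideanSpace.single i 1)

/-- Spatial gradient of a scalar function. -/
def grad (g : R3 → ℝ) (x : R3) : R3 :=
  (WithLp.equiv 2 (Fin 3 → ℝ)).symm (fun i => pd i g x)

/-- Spatial divergence of a vector field on `ℝ³`. -/
def div3 (F : R3 → R3) (x : R3) : ℝ := ∑ i, pd i (fun y => F y i) x

/-- Spatial curl of a vector field on `ℝ³`. -/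
def curl (F : R3 → R3) (x : R3) : R3 :=
  (WithLp.equiv 2 (Fin 3 → ℝ)).symm
    ![pd 1 (fun y => F y 2) x - pd 2 (fun y => F y 1) x,
      pd 2 (fun y => F y 0) x - pd 0 (fun y => F y 2) x,
      pd 0 (fun y => F y 1) x - pd 1 (fun y => F y 0) x]

/-- The Vlasov equation (unit charge) for a distribution `F` with fields `E`, `B`:
`∂tF + v·∇ₓF + (E + v × B)·∇ᵥF = 0`. -/
def VlasovEq (E B : ℝ × R3 → R3) (F : ℝ × R3 × R3 → ℝ) : Prop :=
  ∀ (t : ℝ) (x v : R3),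
    fderiv ℝ (fun s => F (s, x, v)) t 1
      + dot v (grad (fun y => F (t, y, v)) x)
      + dot (E (t, x) + cross v (B (t, x))) (grad (fun w => F (t, x, w)) v) = 0


/-- If `f` is invariant under translations along `w`, then `f` times the derivative along `w` of a
compactly supported `C¹` function has vanishing integral. -/
theorem integral_mul_fderiv_eq_zero_of_invariant {V : Type*} [NormedAddCommGroup V]
    [NormedSpace ℝ V] [FiniteDimensional ℝ V] [MeasurableSpace V] [BorelSpace V]
    {μ : Measure V} [μ.IsAddHaarMeasure] {f g : V → ℝ} {w : V}
    (hg : ContDiff ℝ 1 g) (hgc : HasCompactSupport g) (hf : Continuous f)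
    (hinv : ∀ p (s : ℝ), f (p + s • w) = f p) :
    Integrable (fun p => f p * fderiv ℝ g p w) μ ∧ ∫ p, f p * fderiv ℝ g p w ∂μ = 0 := by
  have hg' : Continuous fun p => fderiv ℝ g p w :=
    (hg.continuous_fderiv one_ne_zero).clm_apply continuous_const
  have hint : Integrable (fun p => f p * fderiv ℝ g p w) μ :=
    (hf.mul hg').integrable_of_hasCompactSupport ((hgc.fderiv_apply (𝕜 := ℝ) w).mul_left)
  refine ⟨hint, ?_⟩
  have h := integral_bilinear_hasLineDerivAt_right_eq_neg_left_of_integrable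
    (μ := μ) (f := f) (f' := fun _ => 0) (g := g) (g' := fun p => fderiv ℝ g p w) (v := w)
    (B := ContinuousLinearMap.mul ℝ ℝ) (by simp) (by simpa using hint)
    ((hf.mul hg.continuous).integrable_of_hasCompactSupport hgc.mul_left)
    (fun p _ => by simpa [HasLineDerivAt, hinv] using hasDerivAt_const (0 : ℝ) (f p))
    (fun p _ => ((hg.differentiable one_ne_zero) p).hasFDerivAt.hasLineDerivAt w)
  simpa using h

/-- Differentiation under the integral sign for a `C¹` family of functions supported in a common
compact set. -/
theorem hasDerivAt_integral_of_contDiff_of_compact {V : Type*} [NormedAddCommGroup V]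
    [NormedSpace ℝ V] [MeasurableSpace V] [BorelSpace V]
    {μ : Measure V} [IsFiniteMeasureOnCompacts μ] {H : ℝ × V → ℝ} (hH : ContDiff ℝ 1 H)
    {K : Set V} (hK : IsCompact K) (hH0 : ∀ t, ∀ p ∉ K, H (t, p) = 0) (t : ℝ) :
    HasDerivAt (fun s => ∫ p, H (s, p) ∂μ) (∫ p, fderiv ℝ H (t, p) (1, 0) ∂μ) t := by
  have hD : Continuous fun q => fderiv ℝ H q (1, 0) :=
    (hH.continuous_fderiv one_ne_zero).clm_apply continuous_const
  have hderiv : ∀ s p, HasDerivAt (fun r => H (r, p)) (fderiv ℝ H (s, p) (1, 0)) s := by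
    intro s p
    exact ((hH.differentiable one_ne_zero) (s, p)).hasFDerivAt.comp_hasDerivAt s
      ((hasDerivAt_id s).prodMk (hasDerivAt_const s p))
  have hD0 : ∀ s, ∀ p ∉ K, fderiv ℝ H (s, p) (1, 0) = 0 := by
    intro s p hp
    refine (hderiv s p).unique ?_
    simpa [hH0 _ p hp] using hasDerivAt_const s (0 : ℝ)
  have hsupp : ∀ {φ : V → ℝ}, Continuous φ → (∀ p ∉ K, φ p = 0) → Integrable φ μ :=
    fun hφ h0 => hφ.integrable_of_hasCompactSupport (HasCompactSupport.intro hK h0)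
  have hslice : ∀ s : ℝ, Continuous fun p : V => (s, p) := fun s => by fun_prop
  obtain ⟨C, hC⟩ := ((isCompact_closedBall t 1).prod hK).exists_bound_of_continuousOn
    hD.continuousOn
  refine (hasDerivAt_integral_of_dominated_loc_of_deriv_le
    (F := fun s p => H (s, p)) (F' := fun s p => fderiv ℝ H (s, p) (1, 0))
    (s := Metric.closedBall t 1) (bound := K.indicator fun _ => C)
    (Metric.closedBall_mem_nhds t one_pos)
    (.of_forall fun s => (hsupp (hH.continuous.comp (hslice s)) (hH0 s)).aestronglyMeasurable)
    (hsupp (hH.continuous.comp (hslice t)) (hH0 t))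
    (hsupp (hD.comp (hslice t)) (hD0 t)).aestronglyMeasurable
    (.of_forall fun p s hs => ?_) ?_ (.of_forall fun p s _ => hderiv s p)).2
  · by_cases hp : p ∈ K
    · simpa [hp] using hC (s, p) ⟨hs, hp⟩
    · simp [hp, hD0 s p hp]
  · exact (integrable_indicator_iff hK.measurableSet).2 (integrableOn_const hK.measure_lt_top.ne)

/-- The Vlasov equation expressed through the total derivative of the distribution. -/
theorem VlasovEq.fderiv_eq {E B : ℝ × R3 → R3} {F : ℝ × R3 × R3 → ℝ}
    (h : VlasovEq E B F) (hF : Differentiable ℝ F) (t : ℝ) (x v : R3) :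
    fderiv ℝ F (t, x, v) (1, 0)
      + ∑ i, v i * fderiv ℝ F (t, x, v) (0, EuclideanSpace.single i 1, 0)
      + ∑ i, (E (t, x) + cross v (B (t, x))) i *
          fderiv ℝ F (t, x, v) (0, 0, EuclideanSpace.single i 1) = 0 := by
  have hFd := (hF (t, x, v)).hasFDerivAt
  have ht : HasFDerivAt (fun s => F (s, x, v)) _ t :=
    hFd.comp t (hasFDerivAt_prodMk_left t (x, v))
  have hx : HasFDerivAt (fun y => F (t, y, v)) _ x :=
    hFd.comp x ((hasFDerivAt_prodMk_right t (x, v)).comp x (hasFDerivAt_prodMk_left x v))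
  have hv : HasFDerivAt (fun w => F (t, x, w)) _ v :=
    hFd.comp v ((hasFDerivAt_prodMk_right t (x, v)).comp v (hasFDerivAt_prodMk_right x v))
  have := h t x v
  simpa [dot, grad, pd, ht.fderiv, hx.fderiv, hv.fderiv] using this

/-- Solutions of the Vlasov equation are stable under composition with a `C¹` function. -/
theorem VlasovEq.fderiv_comp_eq {E B : ℝ × R3 → R3} {F : ℝ × R3 × R3 → ℝ} {Φ : ℝ → ℝ}
    (h : VlasovEq E B F) (hF : Differentiable ℝ F) (hΦ : Differentiable ℝ Φ) (t : ℝ) (x v : R3) :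
    fderiv ℝ (Φ ∘ F) (t, x, v) (1, 0)
      + ∑ i, v i * fderiv ℝ (Φ ∘ F) (t, x, v) (0, EuclideanSpace.single i 1, 0)
      + ∑ i, (E (t, x) + cross v (B (t, x))) i *
          fderiv ℝ (Φ ∘ F) (t, x, v) (0, 0, EuclideanSpace.single i 1) = 0 := by
  have hcomp : ∀ w, fderiv ℝ (Φ ∘ F) (t, x, v) w
      = deriv Φ (F (t, x, v)) * fderiv ℝ F (t, x, v) w := fun w => by
    rw [((hΦ _).hasDerivAt.comp_hasFDerivAt _ (hF (t, x, v)).hasFDerivAt).fderiv]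
    simp
  have := congrArg (deriv Φ (F (t, x, v)) * ·) (h.fderiv_eq hF t x v)
  simp only [mul_add, Finset.mul_sum, mul_zero] at this
  simp only [hcomp]
  simpa only [mul_left_comm] using this

theorem continuous_cross {X : Type*} [TopologicalSpace X] {a b : X → R3} (ha : Continuous a)
    (hb : Continuous b) : Continuous fun p => cross (a p) (b p) := by
  refine (PiLp.continuous_toLp 2 _).comp (continuous_pi fun i => ?_)
  fin_cases i <;> simp <;> fun_prop

/-- The `i`-th component of `v × b` does not depend on the `i`-th component of `v`. -/
theorem cross_add_smul_single_apply (v b : R3) (s : ℝ) (i : Fin 3) :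
    cross (v + s • EuclideanSpace.single i 1) b i = cross v b i := by
  fin_cases i <;> simp [cross]

/-- For any `C¹` function `Φ : ℝ → ℝ` with `Φ(0) = 0`, continuous fields
`E, B`, and a `C¹` compactly supported distribution `F` satisfying the Vlasov equation, the
entropy-type Casimir functional `t ↦ ∫∫ Φ(F(t,x,v)) dx dv` is constant on `ℝ`. -/
theorem casimir_invariance
    (Φ : ℝ → ℝ) (hΦ : ContDiff ℝ 1 Φ) (hΦ0 : Φ 0 = 0)
    (E B : ℝ × R3 → R3) (F : ℝ × R3 × R3 → ℝ)
    (hE : Continuous E) (hB : Continuous B)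
    (hF : ContDiff ℝ 1 F)
    (hsupp : ∃ K : Set (R3 × R3), IsCompact K ∧
      ∀ (t : ℝ) (x v : R3), (x, v) ∉ K → F (t, x, v) = 0)
    (hVlasov : VlasovEq E B F) :
    ∀ t₁ t₂ : ℝ,
      (∫ p : R3 × R3, Φ (F (t₁, p.1, p.2))) = ∫ p : R3 × R3, Φ (F (t₂, p.1, p.2)) := by
  obtain ⟨K, hK, hK0⟩ := hsupp
  have hH : ContDiff ℝ 1 (Φ ∘ F) := hΦ.comp hF
  have hH0 : ∀ t, ∀ p ∉ K, (Φ ∘ F) (t, p) = 0 := fun t p hp => by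
    simp [hK0 t p.1 p.2 hp, hΦ0]
  have hderiv := hasDerivAt_integral_of_contDiff_of_compact (μ := volume) hH hK hH0
  refine is_const_of_deriv_eq_zero (f := fun t => ∫ p : R3 × R3, (Φ ∘ F) (t, p))
    (fun t => (hderiv t).differentiableAt) fun t => (hderiv t).deriv.trans ?_
  have hg : ContDiff ℝ 1 fun p => (Φ ∘ F) (t, p) := hH.comp (contDiff_const.prodMk contDiff_id)
  have hgc : HasCompactSupport fun p => (Φ ∘ F) (t, p) := .intro hK (hH0 t)
  have hfd : ∀ p w, fderiv ℝ (fun q => (Φ ∘ F) (t, q)) p w = fderiv ℝ (Φ ∘ F) (t, p) (0, w) := by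
    intro p w
    have : HasFDerivAt (fun q => (Φ ∘ F) (t, q)) _ p :=
      (hH.differentiable one_ne_zero (t, p)).hasFDerivAt.comp p
        (hasFDerivAt_prodMk_right t p)
    rw [this.fderiv]
    simp
  have hvol : (volume : Measure (R3 × R3)).IsAddHaarMeasure :=
    Measure.prod.instIsAddHaarMeasure volume volume
  have hX := fun i : Fin 3 => integral_mul_fderiv_eq_zero_of_invariant (μ := volume) hg hgc
    (f := fun p => p.2 i) (w := (EuclideanSpace.single i 1, 0)) (by fun_prop) (by simp)
  have hV := fun i : Fin 3 => integral_mul_fderiv_eq_zero_of_invariant (μ := volume) hg hgc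
    (f := fun p => (E (t, p.1) + cross p.2 (B (t, p.1))) i)
    (w := (0, EuclideanSpace.single i 1))
    (by
      have := continuous_cross (a := fun p : R3 × R3 => p.2) (b := fun p => B (t, p.1))
        (by fun_prop) (by fun_prop)
      fun_prop)
    (fun p s => by simp [cross_add_smul_single_apply])
  simp only [hfd] at hX hV
  have hpt : ∀ p : R3 × R3, fderiv ℝ (Φ ∘ F) (t, p) (1, 0)
      = -(∑ i, p.2 i * fderiv ℝ (Φ ∘ F) (t, p) (0, EuclideanSpace.single i 1, 0)
        + ∑ i, (E (t, p.1) + cross p.2 (B (t, p.1))) i *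
          fderiv ℝ (Φ ∘ F) (t, p) (0, 0, EuclideanSpace.single i 1)) := fun p => by
    have := hVlasov.fderiv_comp_eq (hF.differentiable one_ne_zero)
      (hΦ.differentiable one_ne_zero) t p.1 p.2
    linarith
  simp_rw [hpt]
  rw [integral_neg, integral_add (integrable_finsetSum _ fun i _ => (hX i).1)
    (integrable_finsetSum _ fun i _ => (hV i).1), integral_finsetSum _ fun i _ => (hX i).1,
    integral_finsetSum _ fun i _ => (hV i).1]
  simp only [(hX _).2, (hV _).2, Finset.sum_const_zero, add_zero, neg_zero]
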